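/- There exists a universal constant K such that the following holds for all ε, δ ∈ (0, 1/2) and all integers d' ≤ d with d' ≥ K · ε^{−2} · log(1/(εδ)) · log(1/δ). Let H be any d×d orthogonal matrix all of whose entries have absolute value 1/√d, let D be a d×d diagonal matrix whose diagonal entries are independent Rademacher random variables (uniform on {−1, +1}), and let (r_1, …, r_{d'}) be a uniformly random sequence of d' distinct indices from [d], independent of D. Define A : ℝ^d → ℝ^{d'} by (Ax)_j := (H D x)_{r_j}. Then for every x ∈ ℝ^d with ‖x‖₂ = 1, ℙ( |√(d/d') · ‖Ax‖₂ − 1| > ε ) < δ. -/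

import Mathlib

open MeasureTheory

section PermutationAverages

variable {ι κ : Type*} [Fintype ι] [DecidableEq ι]

/-- The sum over all permutations `σ` of `∏ j ∈ J, a (σ j)`. -/
private noncomputable def permSum (a : ι → ℝ) (J : Finset ι) : ℝ :=
  ∑ σ : Equiv.Perm ι, ∏ j ∈ J, a (σ j)

private lemma permSum_insert_le_sum_mul {a : ι → ℝ} (ha : ∀ i, 0 ≤ a i) {J : Finset ι} {k : ι}
    (hk : k ∉ J) (i : ι) :
    permSum a (insert k J) ≤ ∑ σ : Equiv.Perm ι, a (σ i) * ∏ j ∈ J, a (σ j) := by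
  unfold permSum
  by_cases hi : i ∈ J
  · have hki : k ≠ i := fun h => hk (h ▸ hi)
    have hJ : ∀ σ : Equiv.Perm ι,
        ∏ j ∈ J, a (σ j) = a (σ i) * ∏ j ∈ J.erase i, a (σ j) :=
      fun σ => (Finset.mul_prod_erase J (fun j => a (σ j)) hi).symm
    have hswap : ∑ σ : Equiv.Perm ι, a (σ k) * (a (σ k) * ∏ j ∈ J.erase i, a (σ j))
        = ∑ σ : Equiv.Perm ι, a (σ i) * (a (σ i) * ∏ j ∈ J.erase i, a (σ j)) := by
      refine Fintype.sum_equiv (Equiv.mulRight (Equiv.swap i k)) _ _ fun σ => ?_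
      have : ∏ j ∈ J.erase i, a ((σ * Equiv.swap i k) j) = ∏ j ∈ J.erase i, a (σ j) := by
        refine Finset.prod_congr rfl fun j hj => ?_
        have hji := Finset.ne_of_mem_erase hj
        have hjk : j ≠ k := fun h => hk (h ▸ Finset.mem_of_mem_erase hj)
        rw [Equiv.Perm.mul_apply, Equiv.swap_apply_of_ne_of_ne hji hjk]
      simp only [Equiv.coe_mulRight, this]
      simp
    have key : ∑ σ : Equiv.Perm ι, 2 * ∏ j ∈ insert k J, a (σ j)
        ≤ ∑ σ : Equiv.Perm ι, (a (σ i) * (a (σ i) * ∏ j ∈ J.erase i, a (σ j))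
          + a (σ k) * (a (σ k) * ∏ j ∈ J.erase i, a (σ j))) := by
      refine Finset.sum_le_sum fun σ _ => ?_
      rw [Finset.prod_insert hk, hJ]
      have hP : 0 ≤ ∏ j ∈ J.erase i, a (σ j) := Finset.prod_nonneg fun j _ => ha _
      nlinarith [mul_nonneg (sq_nonneg (a (σ i) - a (σ k))) hP]
    rw [← Finset.mul_sum, Finset.sum_add_distrib, hswap] at key
    simp only [hJ]
    linarith
  · refine le_of_eq (Fintype.sum_equiv (Equiv.mulRight (Equiv.swap i k)) _ _ fun σ => ?_)
    rw [Finset.prod_insert hk]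
    have : ∏ j ∈ J, a ((σ * Equiv.swap i k) j) = ∏ j ∈ J, a (σ j) := by
      refine Finset.prod_congr rfl fun j hj => ?_
      have hji : j ≠ i := fun h => hi (h ▸ hj)
      have hjk : j ≠ k := fun h => hk (h ▸ hj)
      rw [Equiv.Perm.mul_apply, Equiv.swap_apply_of_ne_of_ne hji hjk]
    simp only [Equiv.coe_mulRight, this]
    simp

/-- A form of Maclaurin's inequality for elementary symmetric means. -/
private lemma permSum_le {a : ι → ℝ} (ha : ∀ i, 0 ≤ a i) (J : Finset ι) :
    permSum a J ≤ (Fintype.card ι).factorial * ((∑ i, a i) / Fintype.card ι) ^ J.card := by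
  induction J using Finset.induction_on with
  | empty => simp [permSum, Fintype.card_perm]
  | insert k J hk ih =>
    have hcard : (0 : ℝ) < Fintype.card ι := by
      exact_mod_cast Fintype.card_pos_iff.mpr ⟨k⟩
    have hsum : (Fintype.card ι : ℝ) * permSum a (insert k J) ≤ (∑ i, a i) * permSum a J := by
      calc (Fintype.card ι : ℝ) * permSum a (insert k J)
          = ∑ _i : ι, permSum a (insert k J) := by simp
        _ ≤ ∑ i, ∑ σ : Equiv.Perm ι, a (σ i) * ∏ j ∈ J, a (σ j) :=
          Finset.sum_le_sum fun i _ => permSum_insert_le_sum_mul ha hk i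
        _ = (∑ i, a i) * permSum a J := by
          rw [Finset.sum_comm, permSum, Finset.mul_sum]
          refine Finset.sum_congr rfl fun σ _ => ?_
          rw [← Finset.sum_mul, Equiv.sum_comp σ a]
    have hA : 0 ≤ (∑ i, a i) / Fintype.card ι :=
      div_nonneg (Finset.sum_nonneg fun i _ => ha i) hcard.le
    calc permSum a (insert k J) ≤ (∑ i, a i) / Fintype.card ι * permSum a J := by
          rw [div_mul_eq_mul_div, le_div_iff₀ hcard]
          linarith
      _ ≤ (∑ i, a i) / Fintype.card ι *
          ((Fintype.card ι).factorial * ((∑ i, a i) / Fintype.card ι) ^ J.card) :=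
        mul_le_mul_of_nonneg_left ih hA
      _ = _ := by
        rw [Finset.card_insert_of_notMem hk]
        ring

variable [Fintype κ]

private lemma sum_embedding_le_of_forall_perm {g : (κ ↪ ι) → ℝ} {B : ℝ}
    (hg : ∀ e : κ ↪ ι, ∑ σ : Equiv.Perm ι, g (e.trans σ.toEmbedding)
      ≤ (Fintype.card ι).factorial * B) :
    ∑ e, g e ≤ Fintype.card (κ ↪ ι) * B := by
  have hσ : ∀ σ : Equiv.Perm ι, ∑ e : κ ↪ ι, g (e.trans σ.toEmbedding) = ∑ e, g e := fun σ =>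
    Equiv.sum_comp (Equiv.embeddingCongr (Equiv.refl κ) σ) g
  have h : ((Fintype.card ι).factorial : ℝ) * ∑ e, g e
      ≤ (Fintype.card ι).factorial * (Fintype.card (κ ↪ ι) * B) := by
    calc ((Fintype.card ι).factorial : ℝ) * ∑ e, g e
        = ∑ σ : Equiv.Perm ι, ∑ e : κ ↪ ι, g (e.trans σ.toEmbedding) := by
          simp [hσ, Fintype.card_perm]
      _ = ∑ e : κ ↪ ι, ∑ σ : Equiv.Perm ι, g (e.trans σ.toEmbedding) := Finset.sum_comm
      _ ≤ ∑ _e : κ ↪ ι, (Fintype.card ι).factorial * B := Finset.sum_le_sum fun e _ => hg e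
      _ = _ := by
        simp
        ring
  exact le_of_mul_le_mul_left h (by positivity)

/-- Sampling without replacement is dominated by sampling with replacement, for products. -/
private lemma sum_embedding_prod_le {a : ι → ℝ} (ha : ∀ i, 0 ≤ a i) :
    ∑ e : κ ↪ ι, ∏ j, a (e j)
      ≤ Fintype.card (κ ↪ ι) * ((∑ i, a i) / Fintype.card ι) ^ Fintype.card κ := by
  refine sum_embedding_le_of_forall_perm fun e => ?_
  have := permSum_le ha (Finset.univ.map e)
  simpa [permSum] using this

private lemma sum_embedding_apply_le {a : ι → ℝ} (ha : ∀ i, 0 ≤ a i) (j : κ) :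
    ∑ e : κ ↪ ι, a (e j) ≤ Fintype.card (κ ↪ ι) * ((∑ i, a i) / Fintype.card ι) := by
  refine sum_embedding_le_of_forall_perm (g := fun e => a (e j)) fun e => ?_
  have := permSum_le ha {e j}
  simpa [permSum] using this

/-- Moment generating function bound for the centred sum of a sample without replacement. -/
private lemma sum_embedding_exp_le [Nonempty ι] {z : ι → ℝ} {T l : ℝ} (hz : ∀ i, 0 ≤ z i)
    (hzT : ∀ i, z i ≤ T) (hm : (∑ i, z i) / Fintype.card ι ≤ 1) (hl : |l| * T ≤ 1) :
    ∑ e : κ ↪ ι, Real.exp (l * ((∑ j, z (e j))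
        - Fintype.card κ * ((∑ i, z i) / Fintype.card ι)))
      ≤ Fintype.card (κ ↪ ι) * Real.exp (Fintype.card κ * (l ^ 2 * T)) := by
  have hd : (0 : ℝ) < Fintype.card ι := by exact_mod_cast Fintype.card_pos
  have hT : 0 ≤ T := (hz (Classical.arbitrary ι)).trans (hzT _)
  set m := (∑ i, z i) / Fintype.card ι with hm_def
  have hpt : ∀ i, Real.exp (l * z i) ≤ 1 + l * z i + l ^ 2 * T * z i := by
    intro i
    have habs : |l * z i| ≤ 1 := by
      rw [abs_mul, abs_of_nonneg (hz i)]
      exact (mul_le_mul_of_nonneg_left (hzT i) (abs_nonneg l)).trans hl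
    have h1 := (abs_le.mp (Real.abs_exp_sub_one_sub_id_le habs)).2
    have h2 : (l * z i) ^ 2 ≤ l ^ 2 * T * z i := by
      have := mul_le_mul_of_nonneg_left (hzT i) (mul_nonneg (sq_nonneg l) (hz i))
      nlinarith
    linarith
  have hmean : (∑ i, Real.exp (l * z i)) / Fintype.card ι ≤ Real.exp (l * m + l ^ 2 * T) := by
    have h1 : (∑ i, Real.exp (l * z i)) / Fintype.card ι ≤ 1 + l * m + l ^ 2 * T * m := by
      rw [div_le_iff₀ hd]
      refine (Finset.sum_le_sum fun i _ => hpt i).trans (le_of_eq ?_)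
      rw [Finset.sum_add_distrib, Finset.sum_add_distrib, ← Finset.mul_sum, ← Finset.mul_sum]
      simp only [Finset.sum_const, Finset.card_univ, nsmul_eq_mul, mul_one, hm_def]
      field_simp
    have h2 : l ^ 2 * T * m ≤ l ^ 2 * T :=
      mul_le_of_le_one_right (mul_nonneg (sq_nonneg l) hT) hm
    linarith [Real.add_one_le_exp (l * m + l ^ 2 * T)]
  have hprod := sum_embedding_prod_le (κ := κ) (a := fun i => Real.exp (l * z i))
    fun i => (Real.exp_pos _).le
  have hpow : ((∑ i, Real.exp (l * z i)) / Fintype.card ι) ^ Fintype.card κ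
      ≤ Real.exp (Fintype.card κ * (l * m + l ^ 2 * T)) := by
    rw [Real.exp_nat_mul]
    exact pow_le_pow_left₀ (div_nonneg (Finset.sum_nonneg fun i _ => (Real.exp_pos _).le) hd.le)
      hmean _
  calc ∑ e : κ ↪ ι, Real.exp (l * ((∑ j, z (e j)) - Fintype.card κ * m))
      = (∑ e : κ ↪ ι, ∏ j, Real.exp (l * z (e j))) * Real.exp (-(Fintype.card κ * (l * m))) := by
        rw [Finset.sum_mul]
        refine Finset.sum_congr rfl fun e _ => ?_
        rw [← Real.exp_sum, ← Real.exp_add, ← Finset.mul_sum]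
        congr 1
        ring
    _ ≤ (Fintype.card (κ ↪ ι) * Real.exp (Fintype.card κ * (l * m + l ^ 2 * T)))
          * Real.exp (-(Fintype.card κ * (l * m))) := by
        gcongr
        exact hprod.trans (by gcongr)
    _ = _ := by
        rw [mul_assoc, ← Real.exp_add]
        congr 2
        ring

end PermutationAverages

section Signs

variable {ι : Type*} [Fintype ι] [DecidableEq ι]

/-- The finite set of all sign vectors. -/
private noncomputable def signVectors (ι : Type*) [Fintype ι] [DecidableEq ι] :
    Finset (ι → ℝ) :=
  Fintype.piFinset fun _ => {1, -1}

private lemma mem_signVectors {s : ι → ℝ} : s ∈ signVectors ι ↔ ∀ i, s i = 1 ∨ s i = -1 := by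
  simp [signVectors]

private lemma sum_signVectors_exp_le (c : ι → ℝ) :
    ∑ s ∈ signVectors ι, Real.exp (∑ j, c j * s j)
      ≤ 2 ^ Fintype.card ι * Real.exp ((∑ j, c j ^ 2) / 2) := by
  have h1 : ∑ s ∈ signVectors ι, Real.exp (∑ j, c j * s j)
      = ∏ j, ∑ u ∈ ({1, -1} : Finset ℝ), Real.exp (c j * u) := by
    rw [Finset.prod_univ_sum]
    exact Finset.sum_congr rfl fun s _ => Real.exp_sum _ _
  rw [h1, Finset.sum_div, Real.exp_sum, ← Finset.card_univ, ← Finset.prod_const,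
    ← Finset.prod_mul_distrib]
  refine Finset.prod_le_prod (fun j _ => Finset.sum_nonneg fun u _ => (Real.exp_pos _).le)
    fun j _ => ?_
  rw [Finset.sum_pair (by norm_num)]
  have := Real.cosh_le_exp_half_sq (c j)
  rw [Real.cosh_eq] at this
  simp only [mul_one, mul_neg]
  linarith

private lemma sq_sub_min_le {w t : ℝ} (ht : 1 ≤ t) :
    w ^ 2 - min (w ^ 2) (t ^ 2)
      ≤ 2 * Real.exp (-t ^ 2) * (Real.exp (t * w) + Real.exp (-(t * w))) := by
  rcases le_total (w ^ 2) (t ^ 2) with h | h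
  · rw [min_eq_left h, sub_self]
    positivity
  · rw [min_eq_right h]
    have hu : 0 ≤ |w| - t := by
      have := sq_le_sq.mp h
      rw [abs_of_nonneg (by linarith : (0 : ℝ) ≤ t)] at this
      linarith
    have h1 : w ^ 2 - t ^ 2 ≤ 2 * Real.exp (t * (|w| - t)) := by
      have hq := Real.quadratic_le_exp_of_nonneg (mul_nonneg (by linarith : (0 : ℝ) ≤ t) hu)
      have hw : w ^ 2 = |w| ^ 2 := (sq_abs w).symm
      nlinarith [mul_nonneg (mul_nonneg hu hu) (by nlinarith : (0 : ℝ) ≤ t ^ 2 - 1)]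
    have h2 : Real.exp (t * |w|) ≤ Real.exp (t * w) + Real.exp (-(t * w)) := by
      rcases abs_cases w with ⟨h, _⟩ | ⟨h, _⟩ <;> rw [h]
      · linarith [Real.exp_pos (-(t * w))]
      · rw [mul_neg]
        linarith [Real.exp_pos (t * w)]
    have h3 : Real.exp (t * (|w| - t)) = Real.exp (-t ^ 2) * Real.exp (t * |w|) := by
      rw [← Real.exp_add]
      congr 1
      ring
    rw [h3] at h1
    nlinarith [mul_le_mul_of_nonneg_left h2 (Real.exp_pos (-t ^ 2)).le]

/-- The expected excess of the square of a normalized Rademacher sum over a level `t ^ 2`. -/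
private lemma sum_signVectors_excess_le {c : ι → ℝ} (hc : ∑ j, c j ^ 2 = 1) {t : ℝ}
    (ht : 1 ≤ t) :
    ∑ s ∈ signVectors ι, ((∑ j, c j * s j) ^ 2 - min ((∑ j, c j * s j) ^ 2) (t ^ 2))
      ≤ 2 ^ Fintype.card ι * (4 * Real.exp (-(t ^ 2 / 2))) := by
  have hmgf : ∀ l : ℝ, ∑ s ∈ signVectors ι, Real.exp (l * ∑ j, c j * s j)
      ≤ 2 ^ Fintype.card ι * Real.exp (l ^ 2 / 2) := by
    intro l
    have := sum_signVectors_exp_le fun j => l * c j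
    simp only [mul_pow, ← Finset.mul_sum, hc, mul_one, mul_assoc] at this
    exact this
  have h1 := hmgf t
  have h2 := hmgf (-t)
  simp only [neg_mul, even_two.neg_pow] at h2
  calc ∑ s ∈ signVectors ι, ((∑ j, c j * s j) ^ 2 - min ((∑ j, c j * s j) ^ 2) (t ^ 2))
      ≤ ∑ s ∈ signVectors ι, 2 * Real.exp (-t ^ 2) *
          (Real.exp (t * ∑ j, c j * s j) + Real.exp (-(t * ∑ j, c j * s j))) :=
        Finset.sum_le_sum fun s _ => sq_sub_min_le ht
    _ ≤ 2 * Real.exp (-t ^ 2) * (2 ^ Fintype.card ι * Real.exp (t ^ 2 / 2)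
          + 2 ^ Fintype.card ι * Real.exp (t ^ 2 / 2)) := by
        rw [← Finset.mul_sum, Finset.sum_add_distrib]
        gcongr
    _ = _ := by
        have : Real.exp (-(t ^ 2 / 2)) = Real.exp (-t ^ 2) * Real.exp (t ^ 2 / 2) := by
          rw [← Real.exp_add]
          congr 1
          ring
        rw [this]
        ring

end Signs

section Sampling

variable {ι κ : Type*} [Fintype ι] [Fintype κ]

private lemma one_le_of_bad_sample [Nonempty ι] [Nonempty κ] {Z : ι → ℝ} {T ε η l : ℝ}
    (hsum : ∑ i, Z i = Fintype.card ι) (hη : 0 < η) (hε : ε = 4 * η) (hl : 0 < l)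
    (hZ : ∀ i, 0 ≤ Z i) {e : κ → ι}
    (hbad : ε < |Real.sqrt ((∑ j, Z (e j)) / Fintype.card κ) - 1|) :
    1 ≤ (∑ j, (Z (e j) - min (Z (e j)) T)) / (Fintype.card κ * η)
      + (∑ i, (Z i - min (Z i) T)) / (Fintype.card ι * η)
      + Real.exp (l * ((∑ j, min (Z (e j)) T)
          - Fintype.card κ * ((∑ i, min (Z i) T) / Fintype.card ι)))
          * Real.exp (-(l * (Fintype.card κ * η)))
      + Real.exp (-l * ((∑ j, min (Z (e j)) T)
          - Fintype.card κ * ((∑ i, min (Z i) T) / Fintype.card ι)))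
          * Real.exp (-(l * (Fintype.card κ * η))) := by
  have hd : (0 : ℝ) < Fintype.card ι := by exact_mod_cast Fintype.card_pos
  have hk : (0 : ℝ) < Fintype.card κ := by exact_mod_cast Fintype.card_pos
  have hh : ∀ i, 0 ≤ Z i - min (Z i) T := fun i => sub_nonneg.mpr (min_le_left _ _)
  have hS : 0 ≤ ∑ j, (Z (e j) - min (Z (e j)) T) := Finset.sum_nonneg fun j _ => hh _
  have hP : 0 ≤ ∑ i, (Z i - min (Z i) T) := Finset.sum_nonneg fun i _ => hh i
  have hSq : ∑ j, (Z (e j) - min (Z (e j)) T) = ∑ j, Z (e j) - ∑ j, min (Z (e j)) T :=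
    Finset.sum_sub_distrib _ _
  have hPq : ∑ i, (Z i - min (Z i) T) = ∑ i, Z i - ∑ i, min (Z i) T :=
    Finset.sum_sub_distrib _ _
  rw [hsum] at hPq
  by_contra! hlt
  set S := ∑ j, (Z (e j) - min (Z (e j)) T)
  set P := ∑ i, (Z i - min (Z i) T)
  set Y := ∑ j, min (Z (e j)) T
  set M := ∑ i, min (Z i) T
  have e1 := mul_pos (Real.exp_pos (l * (Y - Fintype.card κ * (M / Fintype.card ι))))
    (Real.exp_pos (-(l * (Fintype.card κ * η))))
  have e2 := mul_pos (Real.exp_pos (-l * (Y - Fintype.card κ * (M / Fintype.card ι))))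
    (Real.exp_pos (-(l * (Fintype.card κ * η))))
  have hS0 : 0 ≤ S / (Fintype.card κ * η) := by positivity
  have hP0 : 0 ≤ P / (Fintype.card ι * η) := by positivity
  have hS1 : S < Fintype.card κ * η := by
    rw [← div_lt_one (by positivity)]
    linarith
  have hP1 : P / Fintype.card ι < η := by
    rw [div_lt_iff₀ hd, mul_comm, ← div_lt_one (by positivity)]
    linarith
  have hP2 : 0 ≤ P / Fintype.card ι := by positivity
  have hM : M / Fintype.card ι = 1 - P / Fintype.card ι := by
    rw [hPq]
    field_simp
    ring
  have h3 : Y - Fintype.card κ * (M / Fintype.card ι) < Fintype.card κ * η := by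
    have : Real.exp (l * (Y - Fintype.card κ * (M / Fintype.card ι))
        + -(l * (Fintype.card κ * η))) < 1 := by
      rw [Real.exp_add]
      linarith
    rw [Real.exp_lt_one_iff] at this
    refine lt_of_mul_lt_mul_left ?_ hl.le
    linarith
  have h4 : -(Y - Fintype.card κ * (M / Fintype.card ι)) < Fintype.card κ * η := by
    have : Real.exp (-l * (Y - Fintype.card κ * (M / Fintype.card ι))
        + -(l * (Fintype.card κ * η))) < 1 := by
      rw [Real.exp_add]
      linarith
    rw [Real.exp_lt_one_iff] at this
    refine lt_of_mul_lt_mul_left ?_ hl.le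
    linarith
  set q := (∑ j, Z (e j)) / (Fintype.card κ : ℝ) with hq_def
  have hq0 : 0 ≤ q := div_nonneg (Finset.sum_nonneg fun j _ => hZ _) hk.le
  have hq : ∑ j, Z (e j) = Fintype.card κ * q := by
    rw [hq_def]
    field_simp
  have hq1 : |q - 1| ≤ ε := by
    rw [hM] at h3 h4
    rw [hq] at hSq
    refine abs_le.mpr ⟨?_, ?_⟩ <;> refine le_of_mul_le_mul_left ?_ hk <;> nlinarith
  have hsqrt : |Real.sqrt q - 1| ≤ |q - 1| := by
    have h0 := Real.sqrt_nonneg q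
    have h1 : q - 1 = (Real.sqrt q - 1) * (Real.sqrt q + 1) := by
      nlinarith [Real.sq_sqrt hq0]
    rw [h1, abs_mul, abs_of_nonneg (by linarith : 0 ≤ Real.sqrt q + 1)]
    exact le_mul_of_one_le_right (abs_nonneg _) (by linarith)
  linarith

open Classical in
private lemma card_bad_sample_le [Nonempty ι] [Nonempty κ] {Z : ι → ℝ} {T ε : ℝ}
    (hsum : ∑ i, Z i = Fintype.card ι) (hε : 0 < ε) (hε' : ε ≤ 1) (hT : 0 < T)
    (hZ : ∀ i, 0 ≤ Z i) :
    ((Finset.univ.filter fun e : κ ↪ ι =>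
        ε < |Real.sqrt ((∑ j, Z (e j)) / Fintype.card κ) - 1|).card : ℝ)
      ≤ Fintype.card (κ ↪ ι) * (8 / ε * ((∑ i, (Z i - min (Z i) T)) / Fintype.card ι)
        + 2 * Real.exp (-(Fintype.card κ * ε ^ 2 / (64 * T)))) := by
  have hd : (0 : ℝ) < Fintype.card ι := by exact_mod_cast Fintype.card_pos
  have hk : (0 : ℝ) < Fintype.card κ := by exact_mod_cast Fintype.card_pos
  obtain ⟨η, hη⟩ : ∃ η : ℝ, ε = 4 * η := ⟨ε / 4, by ring⟩
  have hη0 : 0 < η := by linarith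
  set l : ℝ := η / (2 * T) with hl_def
  have hl : 0 < l := by positivity
  have hlT : l * T = η / 2 := by
    rw [hl_def]
    field_simp
  have hh : ∀ i, 0 ≤ Z i - min (Z i) T := fun i => sub_nonneg.mpr (min_le_left _ _)
  have hm : (∑ i, min (Z i) T) / Fintype.card ι ≤ 1 := by
    rw [div_le_one hd, ← hsum]
    exact Finset.sum_le_sum fun i _ => min_le_left _ _
  have hz : ∀ i, 0 ≤ min (Z i) T := fun i => le_min (hZ i) hT.le
  have hup := sum_embedding_exp_le (κ := κ) (T := T) (l := l) hz (fun i => min_le_right _ _) hm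
    (by rw [abs_of_pos hl]; linarith)
  have hlow := sum_embedding_exp_le (κ := κ) (T := T) (l := -l) hz (fun i => min_le_right _ _) hm
    (by rw [abs_neg, abs_of_pos hl]; linarith)
  rw [neg_sq] at hlow
  have hlin : ∑ e : κ ↪ ι, ∑ j, (Z (e j) - min (Z (e j)) T)
      ≤ Fintype.card κ * (Fintype.card (κ ↪ ι)
        * ((∑ i, (Z i - min (Z i) T)) / Fintype.card ι)) := by
    rw [Finset.sum_comm]
    refine (Finset.sum_le_sum fun j _ => sum_embedding_apply_le hh j).trans (le_of_eq ?_)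
    simp
  have hE : Real.exp (Fintype.card κ * (l ^ 2 * T)) * Real.exp (-(l * (Fintype.card κ * η)))
      = Real.exp (-(Fintype.card κ * ε ^ 2 / (64 * T))) := by
    rw [← Real.exp_add, hη, hl_def]
    congr 1
    field_simp
    ring
  set E := Real.exp (-(l * (Fintype.card κ * η)))
  have hE0 : 0 ≤ E := (Real.exp_pos _).le
  rw [Finset.card_filter, Nat.cast_sum]
  calc _ ≤ ∑ e : κ ↪ ι, ((∑ j, (Z (e j) - min (Z (e j)) T)) / (Fintype.card κ * η)
      + (∑ i, (Z i - min (Z i) T)) / (Fintype.card ι * η)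
      + Real.exp (l * ((∑ j, min (Z (e j)) T)
          - Fintype.card κ * ((∑ i, min (Z i) T) / Fintype.card ι))) * E
      + Real.exp (-l * ((∑ j, min (Z (e j)) T)
          - Fintype.card κ * ((∑ i, min (Z i) T) / Fintype.card ι))) * E) := by
        refine Finset.sum_le_sum fun e _ => ?_
        split_ifs with hbad
        · simpa using one_le_of_bad_sample (T := T) hsum hη0 hη hl hZ hbad
        · have h1 : 0 ≤ ∑ j, (Z (e j) - min (Z (e j)) T) := Finset.sum_nonneg fun j _ => hh _
          have h2 : 0 ≤ ∑ i, (Z i - min (Z i) T) := Finset.sum_nonneg fun i _ => hh i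
          simp only [Nat.cast_zero]
          positivity
    _ ≤ (Fintype.card κ * (Fintype.card (κ ↪ ι)
        * ((∑ i, (Z i - min (Z i) T)) / Fintype.card ι))) / (Fintype.card κ * η)
      + Fintype.card (κ ↪ ι) * ((∑ i, (Z i - min (Z i) T)) / (Fintype.card ι * η))
      + (Fintype.card (κ ↪ ι) * Real.exp (Fintype.card κ * (l ^ 2 * T))) * E
      + (Fintype.card (κ ↪ ι) * Real.exp (Fintype.card κ * (l ^ 2 * T))) * E := by
        rw [Finset.sum_add_distrib, Finset.sum_add_distrib, Finset.sum_add_distrib,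
          ← Finset.sum_div, ← Finset.sum_mul, ← Finset.sum_mul, Finset.sum_const,
          Finset.card_univ, nsmul_eq_mul]
        gcongr
    _ = _ := by
        rw [mul_assoc (Fintype.card (κ ↪ ι) : ℝ) _ E, hE, hη]
        field_simp
        ring

end Sampling

private lemma failure_bound_lt {ε δ k : ℝ} (hε : 0 < ε) (hε' : ε < 1 / 2) (hδ : 0 < δ)
    (hδ' : δ < 1 / 2)
    (hk : 2560 * (ε ^ 2)⁻¹ * Real.log (1 / (ε * δ)) * Real.log (1 / δ) ≤ k) :
    8 / ε * (4 * Real.exp (-(10 * Real.log (1 / (ε * δ)) / 2)))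
      + 2 * Real.exp (-(k * ε ^ 2 / (64 * (10 * Real.log (1 / (ε * δ)))))) < δ := by
  have hεδ : 0 < ε * δ := mul_pos hε hδ
  have hεδ1 : ε * δ < 1 / 4 := by nlinarith
  have hL : 0 < Real.log (1 / (ε * δ)) := by
    apply Real.log_pos
    rw [lt_div_iff₀ hεδ]
    linarith
  have h1 : Real.exp (-(10 * Real.log (1 / (ε * δ)) / 2)) = (ε * δ) ^ 5 := by
    rw [one_div, Real.log_inv, show -(10 * -Real.log (ε * δ) / 2) = (5 : ℕ) * Real.log (ε * δ) by
      push_cast; ring, Real.exp_nat_mul, Real.exp_log hεδ]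
  have h2 : Real.exp (-(k * ε ^ 2 / (64 * (10 * Real.log (1 / (ε * δ)))))) ≤ δ ^ 4 := by
    have : δ ^ 4 = Real.exp (-(4 * Real.log (1 / δ))) := by
      rw [one_div, Real.log_inv, show -(4 * -Real.log δ) = (4 : ℕ) * Real.log δ by
        push_cast; ring, Real.exp_nat_mul, Real.exp_log hδ]
    rw [this, Real.exp_le_exp, neg_le_neg_iff, le_div_iff₀ (by positivity)]
    have := mul_le_mul_of_nonneg_right hk (sq_nonneg ε)
    refine le_trans (le_of_eq ?_) this
    field_simp
    ring
  have h3 : 8 / ε * (4 * (ε * δ) ^ 5) = 32 * (ε * δ) ^ 4 * δ := by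
    field_simp
    ring
  have h4 : (ε * δ) ^ 4 ≤ (1 / 4) ^ 4 := pow_le_pow_left₀ hεδ.le hεδ1.le 4
  have h5 : δ ^ 3 ≤ (1 / 2) ^ 3 := pow_le_pow_left₀ hδ.le hδ'.le 3
  have h6 : δ ^ 4 = δ ^ 3 * δ := by ring
  rw [h1, h3]
  rw [h6] at h2
  nlinarith [mul_le_mul_of_nonneg_right h4 hδ.le, mul_le_mul_of_nonneg_right h5 hδ.le]

private lemma one_le_ten_mul_log {ε δ : ℝ} (hε : 0 < ε) (hε' : ε < 1 / 2) (hδ : 0 < δ)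
    (hδ' : δ < 1 / 2) : 1 ≤ 10 * Real.log (1 / (ε * δ)) := by
  have hεδ : 0 < ε * δ := mul_pos hε hδ
  have h : (2 : ℝ) ≤ 1 / (ε * δ) := by
    rw [le_div_iff₀ hεδ]
    nlinarith
  have := Real.log_le_log (by norm_num) h
  linarith [Real.log_two_gt_d9]

open Classical in
private lemma card_bad_pairs_lt {d d' : ℕ} {ε δ : ℝ} (hε : 0 < ε) (hε' : ε < 1 / 2) (hδ : 0 < δ)
    (hδ' : δ < 1 / 2) (hd : 0 < d) (hd' : 0 < d') (hdd : d' ≤ d)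
    (hk : 2560 * (ε ^ 2)⁻¹ * Real.log (1 / (ε * δ)) * Real.log (1 / δ) ≤ (d' : ℝ))
    {H : Matrix (Fin d) (Fin d) ℝ} (hH : H * H.transpose = 1)
    (hent : ∀ i j, |H i j| = 1 / Real.sqrt (d : ℝ)) {x : Fin d → ℝ} (hx : ∑ i, x i ^ 2 = 1) :
    (((signVectors (Fin d) ×ˢ (Finset.univ : Finset (Fin d' ↪ Fin d))).filter fun p =>
      ε < |Real.sqrt ((d : ℝ) / d') * Real.sqrt (∑ j : Fin d',
        (Matrix.mulVec H (fun i => p.1 i * x i) (p.2 j)) ^ 2) - 1|).card : ℝ)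
      < 2 ^ d * Fintype.card (Fin d' ↪ Fin d) * δ := by
  have : Nonempty (Fin d) := ⟨⟨0, hd⟩⟩
  have : Nonempty (Fin d') := ⟨⟨0, hd'⟩⟩
  have hdR : (0 : ℝ) < d := by exact_mod_cast hd
  have hdR' : (0 : ℝ) < d' := by exact_mod_cast hd'
  have hN : (0 : ℝ) < Fintype.card (Fin d' ↪ Fin d) := by
    exact_mod_cast Fintype.card_pos_iff.mpr ⟨Fin.castLEEmb hdd⟩
  set T := 10 * Real.log (1 / (ε * δ)) with hT_def
  have hT : 1 ≤ T := one_le_ten_mul_log hε hε' hδ hδ'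
  set c : Fin d → Fin d → ℝ := fun i j => Real.sqrt d * (H i j * x j) with hc_def
  have hc : ∀ i, ∑ j, c i j ^ 2 = 1 := by
    intro i
    rw [← hx]
    refine Finset.sum_congr rfl fun j _ => ?_
    have : H i j ^ 2 = 1 / d := by
      rw [← sq_abs, hent, div_pow, Real.sq_sqrt hdR.le, one_pow]
    rw [hc_def]
    simp only [mul_pow, this, Real.sq_sqrt hdR.le]
    field_simp
  have hZ : ∀ (s : Fin d → ℝ) i,
      (∑ j, c i j * s j) ^ 2 = d * (Matrix.mulVec H (fun i => s i * x i) i) ^ 2 := by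
    intro s i
    have : ∑ j, c i j * s j = Real.sqrt d * Matrix.mulVec H (fun i => s i * x i) i := by
      rw [Matrix.mulVec, dotProduct, Finset.mul_sum]
      exact Finset.sum_congr rfl fun j _ => by rw [hc_def]; ring
    rw [this, mul_pow, Real.sq_sqrt hdR.le]
  have hsum : ∀ s ∈ signVectors (Fin d), ∑ i, (∑ j, c i j * s j) ^ 2 = Fintype.card (Fin d) := by
    intro s hs
    have hs2 : ∀ i, s i ^ 2 = 1 := fun i => by
      rcases mem_signVectors.mp hs i with h | h <;> rw [h] <;> norm_num
    have hiso : ∀ v : Fin d → ℝ, ∑ i, (Matrix.mulVec H v i) ^ 2 = ∑ i, v i ^ 2 := by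
      intro v
      have : Matrix.mulVec H v ⬝ᵥ Matrix.mulVec H v = v ⬝ᵥ v := by
        rw [Matrix.dotProduct_mulVec, Matrix.vecMul_mulVec, mul_eq_one_comm.mp hH,
          Matrix.vecMul_one]
      simpa [dotProduct, sq] using this
    simp only [hZ, ← Finset.mul_sum, hiso, mul_pow, hs2, one_mul, hx, mul_one, Fintype.card_fin]
  have hcount : ∀ s ∈ signVectors (Fin d),
      ((Finset.univ.filter fun e : Fin d' ↪ Fin d =>
        ε < |Real.sqrt ((d : ℝ) / d') * Real.sqrt (∑ j : Fin d',
          (Matrix.mulVec H (fun i => s i * x i) (e j)) ^ 2) - 1|).card : ℝ)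
      ≤ Fintype.card (Fin d' ↪ Fin d) * (8 / ε * ((∑ i, ((∑ j, c i j * s j) ^ 2
          - min ((∑ j, c i j * s j) ^ 2) T)) / d)
        + 2 * Real.exp (-(d' * ε ^ 2 / (64 * T)))) := by
    intro s hs
    have := card_bad_sample_le (κ := Fin d') (T := T) (hsum s hs) hε (by linarith)
      (by linarith) fun i => sq_nonneg _
    simp only [Fintype.card_fin] at this
    convert this using 8 with e
    rw [← Real.sqrt_mul (by positivity)]
    simp only [hZ, ← Finset.mul_sum]
    congr 1
    ring
  have hexc : ∑ s ∈ signVectors (Fin d), ∑ i, ((∑ j, c i j * s j) ^ 2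
      - min ((∑ j, c i j * s j) ^ 2) T) ≤ d * (2 ^ d * (4 * Real.exp (-(T / 2)))) := by
    rw [Finset.sum_comm]
    have ht : 1 ≤ Real.sqrt T := Real.one_le_sqrt.mpr hT
    have h := fun i => sum_signVectors_excess_le (hc i) ht
    rw [Real.sq_sqrt (by linarith), Fintype.card_fin] at h
    refine (Finset.sum_le_sum fun i _ => h i).trans (le_of_eq ?_)
    simp
  have hcard : ((signVectors (Fin d)).card : ℝ) = 2 ^ d := by
    rw [signVectors, Fintype.card_piFinset_const, Finset.card_pair (by norm_num)]
    simp
  have hlt := failure_bound_lt hε hε' hδ hδ' hk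
  rw [← hT_def] at hlt
  rw [Finset.card_filter, Finset.sum_product]
  push_cast
  calc _ ≤ ∑ s ∈ signVectors (Fin d), (Fintype.card (Fin d' ↪ Fin d) *
        (8 / ε * ((∑ i, ((∑ j, c i j * s j) ^ 2 - min ((∑ j, c i j * s j) ^ 2) T)) / d)
        + 2 * Real.exp (-(d' * ε ^ 2 / (64 * T)))) : ℝ) := by
        refine Finset.sum_le_sum fun s hs => ?_
        refine le_trans (le_of_eq ?_) (hcount s hs)
        rw [Finset.card_filter]
        push_cast
        rfl
    _ = Fintype.card (Fin d' ↪ Fin d) * (8 / ε * ((∑ s ∈ signVectors (Fin d),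
          ∑ i, ((∑ j, c i j * s j) ^ 2 - min ((∑ j, c i j * s j) ^ 2) T)) / d)
        + 2 ^ d * (2 * Real.exp (-(d' * ε ^ 2 / (64 * T))))) := by
        rw [← Finset.mul_sum, Finset.sum_add_distrib, ← Finset.mul_sum, ← Finset.sum_div,
          Finset.sum_const, nsmul_eq_mul, hcard]
    _ ≤ Fintype.card (Fin d' ↪ Fin d) * (8 / ε * ((d * (2 ^ d * (4 * Real.exp (-(T / 2))))) / d)
        + 2 ^ d * (2 * Real.exp (-(d' * ε ^ 2 / (64 * T))))) := by
        gcongr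
    _ = 2 ^ d * Fintype.card (Fin d' ↪ Fin d) * (8 / ε * (4 * Real.exp (-(T / 2)))
        + 2 * Real.exp (-(d' * ε ^ 2 / (64 * T)))) := by
        field_simp
    _ < _ := by
        gcongr

/-- Subsampled randomized Hadamard transform guarantee: there is a universal constant `K` such
that for all `ε, δ ∈ (0, 1/2)` and `d' ≤ d` with `d' ≥ K·ε⁻²·log(1/(εδ))·log(1/δ)`, if `H` is
a `d×d` orthogonal matrix with all entries of absolute value `1/√d`, `D ω` is a vector of
independent Rademacher signs, and `r ω` is a uniformly random sequence of `d'` distinct indices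
of `[d]` independent of `D`, then for `(Ax)_j := (H·D·x)_{r_j}` and every unit `x`,
`ℙ(|√(d/d')·‖Ax‖₂ − 1| > ε) < δ`. -/
theorem fastJL_orthogonal_guarantee :
    ∃ K : ℝ, 0 < K ∧ ∀ ε δ : ℝ, 0 < ε → ε < 1 / 2 → 0 < δ → δ < 1 / 2 →
    ∀ d d' : ℕ, d' ≤ d →
      K * (ε ^ 2)⁻¹ * Real.log (1 / (ε * δ)) * Real.log (1 / δ) ≤ (d' : ℝ) →
    ∀ (H : Matrix (Fin d) (Fin d) ℝ), H * H.transpose = 1 →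
      (∀ i j, |H i j| = 1 / Real.sqrt (d : ℝ)) →
    ∀ {Ω : Type} [inst : MeasurableSpace Ω] (ℙ : Measure Ω), IsProbabilityMeasure ℙ →
    ∀ (D : Ω → Fin d → ℝ) (r : Ω → Fin d' → Fin d),
      (∀ ω i, D ω i = 1 ∨ D ω i = -1) →
      (∀ s : Fin d → ℝ, MeasurableSet {ω | D ω = s}) →
      (∀ s : Fin d → ℝ, (∀ i, s i = 1 ∨ s i = -1) →
        (ℙ {ω | D ω = s}).toReal = (1 / 2 : ℝ) ^ d) →
      (∀ ω, Function.Injective (r ω)) →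
      (∀ f : Fin d' → Fin d, MeasurableSet {ω | r ω = f}) →
      (∀ f : Fin d' → Fin d, Function.Injective f →
        (ℙ {ω | r ω = f}).toReal = (Nat.factorial (d - d') : ℝ) / (Nat.factorial d : ℝ)) →
      (∀ (s : Fin d → ℝ) (f : Fin d' → Fin d),
        (ℙ {ω | D ω = s ∧ r ω = f}).toReal
          = (ℙ {ω | D ω = s}).toReal * (ℙ {ω | r ω = f}).toReal) →
    ∀ x : Fin d → ℝ, Real.sqrt (∑ i, (x i) ^ 2) = 1 →
      (ℙ {ω | |Real.sqrt ((d : ℝ) / (d' : ℝ)) *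
          Real.sqrt (∑ j : Fin d',
            (Matrix.mulVec H (fun i => D ω i * x i) (r ω j)) ^ 2) - 1| > ε}).toReal
        < δ := by
  refine ⟨2560, by norm_num, ?_⟩
  intro ε δ hε hε' hδ hδ' d d' hdd hk H hH hent Ω inst ℙ hP D r hD _ hDp hr _ hrp hind x hx
  classical
  have hd' : 0 < d' := by
    have h1 := one_le_ten_mul_log hε hε' hδ hδ'
    have h2 : 0 < Real.log (1 / δ) := by
      apply Real.log_pos
      rw [lt_div_iff₀ hδ]
      linarith
    have h3 : 0 < Real.log (1 / (ε * δ)) := by linarith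
    have : (0 : ℝ) < d' := lt_of_lt_of_le (by positivity) hk
    exact_mod_cast this
  have hbad := card_bad_pairs_lt hε hε' hδ hδ' (hd'.trans_le hdd) hd' hdd hk hH hent
    (Real.sqrt_eq_one.mp hx)
  set B := (signVectors (Fin d) ×ˢ (Finset.univ : Finset (Fin d' ↪ Fin d))).filter fun p =>
      ε < |Real.sqrt ((d : ℝ) / d') * Real.sqrt (∑ j : Fin d',
        (Matrix.mulVec H (fun i => p.1 i * x i) (p.2 j)) ^ 2) - 1| with hB
  have hN : (0 : ℝ) < Fintype.card (Fin d' ↪ Fin d) := by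
    exact_mod_cast Fintype.card_pos_iff.mpr ⟨Fin.castLEEmb hdd⟩
  have hNinv : (Nat.factorial (d - d') : ℝ) / (Nat.factorial d : ℝ)
      = (Fintype.card (Fin d' ↪ Fin d) : ℝ)⁻¹ := by
    rw [Fintype.card_embedding_eq, Fintype.card_fin, Fintype.card_fin,
      ← Nat.factorial_mul_descFactorial hdd]
    have : (Nat.factorial (d - d') : ℝ) ≠ 0 := by positivity
    push_cast
    field_simp
  have hatom : ∀ p ∈ B, ℙ.real {ω | D ω = p.1 ∧ r ω = p.2}
      = (1 / 2) ^ d * (Fintype.card (Fin d' ↪ Fin d) : ℝ)⁻¹ := by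
    intro p hp
    have hs := mem_signVectors.mp (Finset.mem_product.mp (Finset.mem_filter.mp hp).1).1
    rw [Measure.real, hind, hDp _ hs, hrp _ p.2.injective, hNinv]
  have hsub : {ω | |Real.sqrt ((d : ℝ) / (d' : ℝ)) * Real.sqrt (∑ j : Fin d',
        (Matrix.mulVec H (fun i => D ω i * x i) (r ω j)) ^ 2) - 1| > ε}
      ⊆ ⋃ p ∈ B, {ω | D ω = p.1 ∧ r ω = p.2} := by
    intro ω hω
    simp only [Set.mem_iUnion]
    refine ⟨(D ω, ⟨r ω, hr ω⟩), ?_, rfl, rfl⟩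
    rw [hB, Finset.mem_filter]
    exact ⟨Finset.mem_product.mpr ⟨mem_signVectors.mpr (hD ω), Finset.mem_univ _⟩, hω⟩
  calc _ ≤ ℙ.real (⋃ p ∈ B, {ω | D ω = p.1 ∧ r ω = p.2}) := measureReal_mono hsub (measure_ne_top _ _)
    _ ≤ ∑ p ∈ B, ℙ.real {ω | D ω = p.1 ∧ r ω = p.2} := measureReal_biUnion_finset_le _ _
    _ = B.card * ((1 / 2) ^ d * (Fintype.card (Fin d' ↪ Fin d) : ℝ)⁻¹) := by
      rw [Finset.sum_congr rfl hatom, Finset.sum_const, nsmul_eq_mul]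
    _ < (2 ^ d * Fintype.card (Fin d' ↪ Fin d) * δ)
        * ((1 / 2) ^ d * (Fintype.card (Fin d' ↪ Fin d) : ℝ)⁻¹) := by
      gcongr
    _ = δ := by
      rw [one_div, inv_pow]
      field_simp
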